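/- arXiv:0802.1060 — 2 statements merged into one kernel-verified Lean document; each statement's English description precedes it below -/
import Mathlib

section
/- Let k be a field of characteristic 0 and let e ≤ f be positive integers. Consider R = k[x, y]/(x^e, y^f) as a module over the polynomial ring k[t], where t acts as multiplication by (x + y). Then R is isomorphic as a k[t]-module to the direct sum ⊕_{d=0}^{e−1} k[t]/(t^{e+f−1−2d}). -/
open MvPolynomial

/-- The `k[t]`-module structure on `R = k[x,y]/(x^e, y^f)` in which `t` acts as
multiplication by `x + y`. -/
noncomputable instance tPolyModule (k : Type*) [CommRing k] (e f : ℕ) :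
    Module (Polynomial k)
      (MvPolynomial (Fin 2) k ⧸
        Ideal.span {(X 0 : MvPolynomial (Fin 2) k) ^ e, (X 1 : MvPolynomial (Fin 2) k) ^ f}) :=
  Module.compHom _
    (Polynomial.aeval
      (Ideal.Quotient.mk
        (Ideal.span {(X 0 : MvPolynomial (Fin 2) k) ^ e, (X 1 : MvPolynomial (Fin 2) k) ^ f})
        (X 0 + X 1))).toRingHom

/-- The second order operator `m ∂ᵢ - xᵢ ∂ᵢ²`, which lowers degrees by one and preserves
the ideal generated by `xᵢ ^ (m + 1)`. -/
noncomputable def lowering {σ : Type*} (k : Type*) [CommRing k] (i : σ) (m : ℕ) :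
    MvPolynomial σ k →ₗ[k] MvPolynomial σ k :=
  m • (pderiv i).toLinearMap -
    LinearMap.mulLeft k (X i) ∘ₗ (pderiv i).toLinearMap ∘ₗ (pderiv i).toLinearMap

section Lowering

variable {σ k : Type*} [CommRing k]

theorem lowering_apply (i : σ) (m : ℕ) (p : MvPolynomial σ k) :
    lowering k i m p = (m : MvPolynomial σ k) * pderiv i p - X i * pderiv i (pderiv i p) := by
  simp [lowering]

theorem lowering_mul_of_pderiv_eq_zero (i : σ) (m : ℕ) {q : MvPolynomial σ k}
    (hq : pderiv i q = 0) (p : MvPolynomial σ k) :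
    lowering k i m (q * p) = q * lowering k i m p := by
  simp only [lowering_apply, Derivation.leibniz, hq, smul_eq_mul, mul_zero, add_zero]
  ring

theorem lowering_X_mul (i : σ) (m : ℕ) (p : MvPolynomial σ k) :
    lowering k i m (X i * p) = X i * lowering k i m p +
      (m : MvPolynomial σ k) * p - 2 * (X i * pderiv i p) := by
  simp only [lowering_apply, Derivation.leibniz, map_add, smul_eq_mul, pderiv_X_self, mul_one]
  ring

theorem lowering_X_pow_succ_mul (i : σ) (m a : ℕ) (p : MvPolynomial σ k) :
    lowering k i m (X i ^ (a + 1) * p) = X i ^ (a + 1) * lowering k i m p +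
      ((a + 1 : ℕ) : MvPolynomial σ k) * ((m : MvPolynomial σ k) - (a : MvPolynomial σ k)) *
        (X i ^ a * p) - 2 * ((a + 1 : ℕ) : MvPolynomial σ k) * (X i ^ (a + 1) * pderiv i p) := by
  induction a with
  | zero => simp [lowering_X_mul]
  | succ a ih =>
    rw [pow_succ' _ (a + 1), mul_assoc, lowering_X_mul, ih, Derivation.leibniz, Derivation.leibniz_pow,
      pderiv_X_self]
    simp only [smul_eq_mul, nsmul_eq_mul, Nat.add_sub_cancel]
    push_cast
    ring

theorem lowering_one (i : σ) (m : ℕ) : lowering k i m 1 = 0 := by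
  simp [lowering_apply]

theorem lowering_X_pow_succ (i : σ) (m a : ℕ) :
    lowering k i m (X i ^ (a + 1)) =
      ((a + 1 : ℕ) : MvPolynomial σ k) * ((m : MvPolynomial σ k) - (a : MvPolynomial σ k)) *
        X i ^ a := by
  simpa [lowering_one] using lowering_X_pow_succ_mul (k := k) i m a 1

end Lowering

section TwoVariables

variable {k : Type*} [Field k]

theorem pderiv_X_pow_of_ne {σ : Type*} {i j : σ} (h : j ≠ i) (a : ℕ) :
    pderiv i (X j ^ a : MvPolynomial σ k) = 0 := by
  simp [Derivation.leibniz_pow, pderiv_X_of_ne h]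

/-- The lowering operator of the `sl₂`-action on `k[x, y]/(x^(m+1), y^(n+1))`. -/
noncomputable def lowering₂ (k : Type*) [Field k] (m n : ℕ) :
    MvPolynomial (Fin 2) k →ₗ[k] MvPolynomial (Fin 2) k :=
  lowering k 0 m + lowering k 1 n

/-- The ideal `(x^e, y^f)`. -/
noncomputable abbrev powIdeal (k : Type*) [Field k] (e f : ℕ) : Ideal (MvPolynomial (Fin 2) k) :=
  Ideal.span {(X 0 : MvPolynomial (Fin 2) k) ^ e, (X 1 : MvPolynomial (Fin 2) k) ^ f}

theorem lowering₂_mem (m n : ℕ) {p : MvPolynomial (Fin 2) k}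
    (hp : p ∈ powIdeal k (m + 1) (n + 1)) :
    lowering₂ k m n p ∈ powIdeal k (m + 1) (n + 1) := by
  obtain ⟨a, b, rfl⟩ := Ideal.mem_span_pair.1 hp
  refine Ideal.mem_span_pair.2
    ⟨lowering₂ k m n a - 2 * ((m + 1 : ℕ) : MvPolynomial (Fin 2) k) * pderiv 0 a,
      lowering₂ k m n b - 2 * ((n + 1 : ℕ) : MvPolynomial (Fin 2) k) * pderiv 1 b, ?_⟩
  rw [mul_comm a, mul_comm b]
  simp only [lowering₂, LinearMap.add_apply, map_add, lowering_X_pow_succ_mul,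
    lowering_mul_of_pderiv_eq_zero 0 m (pderiv_X_pow_of_ne (k := k) (one_ne_zero' (Fin 2)) (n + 1)),
    lowering_mul_of_pderiv_eq_zero 1 n (pderiv_X_pow_of_ne (k := k) (zero_ne_one' (Fin 2)) (m + 1))]
  ring

theorem lowering₂_mul (m n : ℕ) (p : MvPolynomial (Fin 2) k) :
    lowering₂ k m n ((X 0 + X 1) * p) = (X 0 + X 1) * lowering₂ k m n p +
      ((m + n : ℕ) : MvPolynomial (Fin 2) k) * p -
      2 * (X 0 * pderiv 0 p + X 1 * pderiv 1 p) := by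
  have h0 : pderiv 0 (X 1 : MvPolynomial (Fin 2) k) = 0 := pderiv_X_of_ne (by decide)
  have h1 : pderiv 1 (X 0 : MvPolynomial (Fin 2) k) = 0 := pderiv_X_of_ne (by decide)
  simp only [lowering₂, LinearMap.add_apply, add_mul, map_add, lowering_X_mul,
    lowering_mul_of_pderiv_eq_zero 0 m h0, lowering_mul_of_pderiv_eq_zero 1 n h1]
  push_cast
  ring

theorem euler_mul_pow {u : MvPolynomial (Fin 2) k} {d : ℕ}
    (hu : X 0 * pderiv 0 u + X 1 * pderiv 1 u = (d : MvPolynomial (Fin 2) k) * u) (j : ℕ) :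
    X 0 * pderiv 0 ((X 0 + X 1) ^ j * u) + X 1 * pderiv 1 ((X 0 + X 1) ^ j * u) =
      ((j + d : ℕ) : MvPolynomial (Fin 2) k) * ((X 0 + X 1) ^ j * u) := by
  have h0 : pderiv 0 (X 1 : MvPolynomial (Fin 2) k) = 0 := pderiv_X_of_ne (by decide)
  have h1 : pderiv 1 (X 0 : MvPolynomial (Fin 2) k) = 0 := pderiv_X_of_ne (by decide)
  induction j with
  | zero => simpa using hu
  | succ j ih =>
    rw [pow_succ', mul_assoc]
    generalize (X 0 + X 1) ^ j * u = p at ih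
    simp only [Derivation.leibniz, map_add, pderiv_X_self, h0, h1, smul_eq_mul]
    push_cast at ih ⊢
    linear_combination (X 0 + X 1) * ih

theorem lowering₂_pow_succ_mul (m n : ℕ) {u : MvPolynomial (Fin 2) k} {d : ℕ}
    (hu : X 0 * pderiv 0 u + X 1 * pderiv 1 u = (d : MvPolynomial (Fin 2) k) * u)
    (h : lowering₂ k m n u = 0) (j : ℕ) :
    lowering₂ k m n ((X 0 + X 1) ^ (j + 1) * u) =
      ((j + 1 : ℕ) : MvPolynomial (Fin 2) k) *
        (((m + n : ℕ) : MvPolynomial (Fin 2) k) - ((2 * d + j : ℕ) : MvPolynomial (Fin 2) k)) *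
        ((X 0 + X 1) ^ j * u) := by
  induction j with
  | zero =>
    rw [pow_succ', mul_assoc, lowering₂_mul, euler_mul_pow hu]
    simp only [pow_zero, one_mul, h]
    push_cast
    ring
  | succ j ih =>
    rw [pow_succ', mul_assoc, lowering₂_mul, ih, euler_mul_pow hu]
    push_cast
    ring

theorem pow_add_mem_powIdeal (e f : ℕ) :
    (X 0 + X 1 : MvPolynomial (Fin 2) k) ^ (e + f) ∈ powIdeal k e f :=
  Ideal.add_pow_mem_of_pow_mem_of_le (m := e) (n := f) _ (Ideal.subset_span (by simp))
    (Ideal.subset_span (by simp)) (by omega)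

theorem pow_mul_mem_powIdeal [CharZero k] (m n : ℕ) {u : MvPolynomial (Fin 2) k} {d : ℕ}
    (hu : X 0 * pderiv 0 u + X 1 * pderiv 1 u = (d : MvPolynomial (Fin 2) k) * u)
    (h : lowering₂ k m n u = 0)
    (hd : 2 * d ≤ m + n) :
    (X 0 + X 1) ^ (m + n + 1 - 2 * d) * u ∈ powIdeal k (m + 1) (n + 1) := by
  obtain ⟨a, ha⟩ := Nat.exists_eq_add_of_le hd
  rw [show m + n + 1 - 2 * d = a + 1 by omega]
  have key : ∀ j, (X 0 + X 1) ^ (a + 1 + j) * u ∈ powIdeal k (m + 1) (n + 1) →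
      (X 0 + X 1) ^ (a + 1) * u ∈ powIdeal k (m + 1) (n + 1) := by
    intro j
    induction j with
    | zero => exact id
    | succ j ih =>
      intro hj
      refine ih ?_
      have h1 := lowering₂_mem m n hj
      rw [← add_assoc, lowering₂_pow_succ_mul m n hu h] at h1
      have h2 : ((a + 1 + j + 1 : ℕ) : MvPolynomial (Fin 2) k) *
          (((m + n : ℕ) : MvPolynomial (Fin 2) k) -
            ((2 * d + (a + 1 + j) : ℕ) : MvPolynomial (Fin 2) k)) =
          C (-((a + 1 + j + 1 : ℕ) * (j + 1 : ℕ) : k)) := by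
        rw [ha]
        simp only [map_neg, map_mul, map_natCast]
        push_cast
        ring
      rw [h2] at h1
      have hne : (-((a + 1 + j + 1 : ℕ) * (j + 1 : ℕ) : k)) ≠ 0 :=
        neg_ne_zero.2 (mul_ne_zero (Nat.cast_ne_zero.2 (by omega)) (Nat.cast_ne_zero.2 (by omega)))
      have h3 := Ideal.mul_mem_left _ (C (-((a + 1 + j + 1 : ℕ) * (j + 1 : ℕ) : k))⁻¹) h1
      rwa [← mul_assoc, ← C_mul, inv_mul_cancel₀ hne, C_1, one_mul] at h3
  refine key (2 * d + 1) ?_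
  rw [show a + 1 + (2 * d + 1) = (m + 1) + (n + 1) by omega]
  exact Ideal.mul_mem_right _ _ (pow_add_mem_powIdeal _ _)

/-- Absolute values of the coefficients of `highestWeightVector`. -/
def highestWeightCoeff (m n d i : ℕ) : ℕ :=
  d.choose i * (n - d + i).factorial * (m - i).factorial

theorem highestWeightCoeff_pos {d i : ℕ} (m n : ℕ) (hi : i ≤ d) :
    0 < highestWeightCoeff m n d i := by
  have := Nat.choose_pos hi
  unfold highestWeightCoeff
  positivity

theorem highestWeightCoeff_succ {m n d i : ℕ} (hdm : d ≤ m) (hi : i < d) :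
    highestWeightCoeff m n d (i + 1) * ((i + 1) * (m - i)) =
      highestWeightCoeff m n d i * ((d - i) * (n - d + i + 1)) := by
  have h := Nat.choose_succ_right_eq d i
  obtain ⟨c, hc⟩ : ∃ c, m - i = c + 1 := ⟨m - i - 1, by omega⟩
  have hc' : m - (i + 1) = c := by omega
  unfold highestWeightCoeff
  rw [hc, hc', ← add_assoc, Nat.factorial_succ, Nat.factorial_succ]
  linear_combination (n - d + i + 1) * (n - d + i).factorial * (c + 1) * c.factorial * h

/-- A homogeneous polynomial of degree `d` killed by the lowering operator. -/
noncomputable def highestWeightVector (k : Type*) [Field k] (m n d : ℕ) :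
    MvPolynomial (Fin 2) k :=
  ∑ i ∈ Finset.range (d + 1),
    ((-1) ^ i * (highestWeightCoeff m n d i : k)) • (X 0 ^ i * X 1 ^ (d - i))

theorem X_mul_pderiv_X_pow {σ : Type*} (i : σ) (a : ℕ) :
    X i * pderiv i (X i ^ a : MvPolynomial σ k) = (a : MvPolynomial σ k) * X i ^ a := by
  cases a with
  | zero => simp
  | succ a =>
    simp [Derivation.leibniz_pow]
    ring

theorem euler_highestWeightVector (m n d : ℕ) :
    X 0 * pderiv 0 (highestWeightVector k m n d) + X 1 * pderiv 1 (highestWeightVector k m n d) =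
      (d : MvPolynomial (Fin 2) k) * highestWeightVector k m n d := by
  simp only [highestWeightVector, map_sum, Finset.mul_sum, ← Finset.sum_add_distrib]
  refine Finset.sum_congr rfl fun i hi => ?_
  have hi' : i + (d - i) = d := by have := Finset.mem_range.1 hi; omega
  have hd : (d : MvPolynomial (Fin 2) k) = i + (d - i : ℕ) := by exact_mod_cast congrArg _ hi'.symm
  have h0 := X_mul_pderiv_X_pow (k := k) (0 : Fin 2) i
  have h1 := X_mul_pderiv_X_pow (k := k) (1 : Fin 2) (d - i)
  simp only [Derivation.map_smul, Derivation.leibniz, smul_eq_mul, mul_smul_comm, ← smul_add,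
    pderiv_X_pow_of_ne (k := k) (one_ne_zero' (Fin 2)),
    pderiv_X_pow_of_ne (k := k) (zero_ne_one' (Fin 2))]
  congr 1
  rw [hd]
  linear_combination X 1 ^ (d - i) * h0 + X 0 ^ i * h1

theorem lowering₂_highestWeightVector {m n d : ℕ} (hdm : d ≤ m) (hdn : d ≤ n) :
    lowering₂ k m n (highestWeightVector k m n d) = 0 := by
  have hA (i : ℕ) : lowering k 0 m (X 0 ^ i * X 1 ^ (d - i)) =
      X 1 ^ (d - i) * lowering k (0 : Fin 2) m (X 0 ^ i) := by
    rw [mul_comm, lowering_mul_of_pderiv_eq_zero _ _ (pderiv_X_pow_of_ne (one_ne_zero' (Fin 2)) _)]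
  have hB (i : ℕ) : lowering k 1 n (X 0 ^ i * X 1 ^ (d - i)) =
      X 0 ^ i * lowering k (1 : Fin 2) n (X 1 ^ (d - i)) :=
    lowering_mul_of_pderiv_eq_zero _ _ (pderiv_X_pow_of_ne (zero_ne_one' (Fin 2)) _) _
  simp only [highestWeightVector, map_sum, map_smul, lowering₂, LinearMap.add_apply, hA, hB,
    smul_add, Finset.sum_add_distrib]
  rw [Finset.sum_range_succ', Finset.sum_range_succ _ d]
  simp only [pow_zero, Nat.sub_self, lowering_one, mul_zero, smul_zero, add_zero]
  rw [← Finset.sum_add_distrib]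
  refine Finset.sum_eq_zero fun i hi => ?_
  have hi := Finset.mem_range.1 hi
  obtain ⟨b, rfl⟩ : ∃ b, d = i + b + 1 := ⟨d - i - 1, by omega⟩
  obtain ⟨c, rfl⟩ : ∃ c, m = i + b + 1 + c := ⟨_, (Nat.add_sub_of_le hdm).symm⟩
  obtain ⟨g, rfl⟩ : ∃ g, n = i + b + 1 + g := ⟨_, (Nat.add_sub_of_le hdn).symm⟩
  have h := highestWeightCoeff_succ (n := i + b + 1 + g) hdm hi
  generalize highestWeightCoeff (i + b + 1 + c) (i + b + 1 + g) (i + b + 1) = w at h ⊢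
  rw [show i + b + 1 + c - i = b + 1 + c by omega, show i + b + 1 - i = b + 1 by omega,
    Nat.add_sub_cancel_left] at h
  rw [show i + b + 1 - i = b + 1 by omega, show i + b + 1 - (i + 1) = b by omega,
    lowering_X_pow_succ, lowering_X_pow_succ]
  have h' := congrArg (Nat.cast : ℕ → MvPolynomial (Fin 2) k) h
  simp only [smul_eq_C_mul, map_mul, map_pow, map_neg, map_natCast, C_1]
  push_cast at h' ⊢
  linear_combination (-1) ^ (i + 1) * X 0 ^ i * X 1 ^ b * h'

theorem highestWeightVector_sub_smul_X_pow_mem (m n d : ℕ) :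
    X 0 + X 1 ∣ highestWeightVector k m n d -
      (∑ i ∈ Finset.range (d + 1), (highestWeightCoeff m n d i : k)) •
        ((-1) ^ d * X 0 ^ d : MvPolynomial (Fin 2) k) := by
  rw [highestWeightVector, Finset.sum_smul, ← Finset.sum_sub_distrib]
  refine Finset.dvd_sum fun i hi => ?_
  obtain ⟨b, rfl⟩ := Nat.exists_eq_add_of_le (Nat.lt_succ_iff.1 (Finset.mem_range.1 hi))
  have h : (X 0 + X 1 : MvPolynomial (Fin 2) k) ∣ X 1 ^ b - (-X 0) ^ b := by
    convert sub_dvd_pow_sub_pow (X 1 : MvPolynomial (Fin 2) k) (-X 0) b using 1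
    ring
  obtain ⟨q, hq⟩ := h
  refine ⟨(-1) ^ i * (highestWeightCoeff m n (i + b) i : MvPolynomial (Fin 2) k) * X 0 ^ i * q, ?_⟩
  rw [Nat.add_sub_cancel_left]
  have h1 : ((-1) ^ i * (-1) ^ i : MvPolynomial (Fin 2) k) = 1 := by
    rw [← mul_pow]; simp
  rw [neg_pow] at hq
  simp only [smul_eq_C_mul, map_mul, map_pow, map_neg, map_natCast, C_1]
  linear_combination (-1) ^ i * (highestWeightCoeff m n (i + b) i : MvPolynomial (Fin 2) k) *
    X 0 ^ i * hq

theorem X_pow_mem_of_highestWeightVector_mem [CharZero k] (m n d : ℕ)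
    {V : Submodule k (MvPolynomial (Fin 2) k)} (hV : ∀ q, (X 0 + X 1) * q ∈ V)
    (hd : highestWeightVector k m n d ∈ V) : X 0 ^ d ∈ V := by
  obtain ⟨q, hq⟩ := highestWeightVector_sub_smul_X_pow_mem (k := k) m n d
  have h := V.sub_mem hd (hV q)
  rw [← hq, sub_sub_cancel] at h
  have hne : (∑ i ∈ Finset.range (d + 1), (highestWeightCoeff m n d i : k)) ≠ 0 := by
    rw [← Nat.cast_sum, Nat.cast_ne_zero]
    exact (Finset.sum_pos (fun i hi => highestWeightCoeff_pos m n
      (Nat.lt_succ_iff.1 (Finset.mem_range.1 hi))) ⟨0, by simp⟩).ne'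
  have h' := (V.smul_mem_iff hne).1 h
  rcases neg_one_pow_eq_or (MvPolynomial (Fin 2) k) d with h1 | h1 <;> simpa [h1] using h'

theorem eq_top_of_X_pow_mem {e : ℕ}
    {V : Submodule k (MvPolynomial (Fin 2) k)} (hV : ∀ q, (X 0 + X 1) * q ∈ V)
    (hI : ∀ q, X 0 ^ e * q ∈ V) (hX : ∀ d < e, X 0 ^ d ∈ V) : V = ⊤ := by
  have hX' (d : ℕ) : X 0 ^ d ∈ V := by
    rcases lt_or_ge d e with h | h
    · exact hX d h
    · rw [← Nat.add_sub_of_le h, pow_add]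
      exact hI _
  refine eq_top_iff.2 fun p _ => ?_
  induction p using MvPolynomial.induction_on' with
  | add p q hp hq => exact V.add_mem (hp trivial) (hq trivial)
  | monomial s a =>
    obtain ⟨q, hq⟩ : (X 0 + X 1 : MvPolynomial (Fin 2) k) ∣ X 1 ^ s 1 - (-X 0) ^ s 1 := by
      convert sub_dvd_pow_sub_pow (X 1 : MvPolynomial (Fin 2) k) (-X 0) (s 1) using 1
      ring
    have h1 : X 0 ^ (s 0 + s 1) ∈ V := hX' _
    have h2 : monomial s a =
        a • ((X 0 + X 1) * (X 0 ^ s 0 * q)) + (a * (-1) ^ s 1) • X 0 ^ (s 0 + s 1) := by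
      rw [monomial_eq, Finsupp.prod_fintype _ _ (by simp), Fin.prod_univ_two]
      rw [neg_pow] at hq
      simp only [smul_eq_C_mul, map_mul, map_pow, map_neg, C_1]
      linear_combination C a * X 0 ^ s 0 * hq
    rw [h2]
    exact V.add_mem (V.smul_mem _ (hV _)) (V.smul_mem _ h1)

/-- The coefficients of the monomials `x^i y^j` with `i < e` and `j < f`. -/
noncomputable def boxCoeff (k : Type*) [Field k] (e f : ℕ) :
    MvPolynomial (Fin 2) k →ₗ[k] (Fin e × Fin f → k) :=
  LinearMap.pi fun ij => lcoeff k (Finsupp.single 0 (ij.1 : ℕ) + Finsupp.single 1 (ij.2 : ℕ))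

theorem boxCoeff_eq_zero {e f : ℕ} {p : MvPolynomial (Fin 2) k} (hp : p ∈ powIdeal k e f) :
    boxCoeff k e f p = 0 := by
  obtain ⟨a, b, rfl⟩ := Ideal.mem_span_pair.1 hp
  ext ⟨i, j⟩
  simp only [boxCoeff, LinearMap.pi_apply, lcoeff_apply, coeff_add, Pi.zero_apply,
    X_pow_eq_monomial, coeff_mul_monomial']
  rw [if_neg, if_neg, add_zero]
  · intro h
    have := h 1
    simp at this
    omega
  · intro h
    have := h 0
    simp at this
    omega

theorem boxCoeff_surjective (e f : ℕ) : Function.Surjective (boxCoeff k e f) := by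
  intro c
  refine ⟨∑ ij : Fin e × Fin f,
    monomial (Finsupp.single 0 (ij.1 : ℕ) + Finsupp.single 1 (ij.2 : ℕ)) (c ij), ?_⟩
  ext ij
  simp only [boxCoeff, LinearMap.pi_apply, lcoeff_apply, coeff_sum, coeff_monomial]
  rw [Finset.sum_eq_single ij]
  · simp
  · intro b _ hb
    rw [if_neg]
    intro h
    have h0 := DFunLike.congr_fun h 0
    have h1 := DFunLike.congr_fun h 1
    simp at h0 h1
    exact hb (Prod.ext (Fin.ext h0) (Fin.ext h1))
  · simp

end TwoVariables

section Decomposition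

variable {k : Type*} [Field k]

theorem tPolyModule_smul_def {e f : ℕ} (p : Polynomial k)
    (r : MvPolynomial (Fin 2) k ⧸ powIdeal k e f) :
    p • r = Polynomial.aeval (Ideal.Quotient.mk (powIdeal k e f) (X 0 + X 1)) p * r :=
  rfl

theorem X_pow_smul_mk {e f : ℕ} (j : ℕ) (q : MvPolynomial (Fin 2) k) :
    (Polynomial.X ^ j : Polynomial k) • Ideal.Quotient.mk (powIdeal k e f) q =
      Ideal.Quotient.mk (powIdeal k e f) ((X 0 + X 1) ^ j * q) := by
  rw [tPolyModule_smul_def, map_pow, Polynomial.aeval_X, map_mul, map_pow]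

instance tPolyModule_isScalarTower (e f : ℕ) :
    IsScalarTower k (Polynomial k) (MvPolynomial (Fin 2) k ⧸ powIdeal k e f) where
  smul_assoc c p r := by
    rw [tPolyModule_smul_def, tPolyModule_smul_def, map_smul, smul_mul_assoc]

theorem X_pow_smul_mk_highestWeightVector [CharZero k] {m n d : ℕ} (hdm : d ≤ m) (hdn : d ≤ n) :
    (Polynomial.X ^ (m + 1 + (n + 1) - 1 - 2 * d) : Polynomial k) •
      Ideal.Quotient.mk (powIdeal k (m + 1) (n + 1)) (highestWeightVector k m n d) = 0 := by
  rw [X_pow_smul_mk, Ideal.Quotient.eq_zero_iff_mem,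
    show m + 1 + (n + 1) - 1 - 2 * d = m + n + 1 - 2 * d by omega]
  exact pow_mul_mem_powIdeal m n (euler_highestWeightVector m n d)
    (lowering₂_highestWeightVector hdm hdn) (by omega)

/-- The map sending the generator of the `d`-th summand to the `d`-th highest weight vector. -/
noncomputable def decompositionMap (k : Type*) [Field k] [CharZero k] {m n : ℕ} (hmn : m ≤ n) :
    ((d : Fin (m + 1)) → Polynomial k ⧸
      Ideal.span {(Polynomial.X : Polynomial k) ^ (m + 1 + (n + 1) - 1 - 2 * (d : ℕ))})
    →ₗ[Polynomial k] (MvPolynomial (Fin 2) k ⧸ powIdeal k (m + 1) (n + 1)) :=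
  ∑ d : Fin (m + 1), (Submodule.liftQ _ (LinearMap.toSpanSingleton (Polynomial k) _
    (Ideal.Quotient.mk (powIdeal k (m + 1) (n + 1)) (highestWeightVector k m n d)))
    (by
      rw [Ideal.span, Submodule.span_singleton_le_iff_mem, LinearMap.mem_ker,
        LinearMap.toSpanSingleton_apply]
      exact X_pow_smul_mk_highestWeightVector (by omega) (by omega))) ∘ₗ LinearMap.proj d

theorem mk_highestWeightVector_mem_range [CharZero k] {m n : ℕ} (hmn : m ≤ n) {d : ℕ}
    (hd : d < m + 1) :
    Ideal.Quotient.mk (powIdeal k (m + 1) (n + 1)) (highestWeightVector k m n d) ∈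
      LinearMap.range (decompositionMap k hmn) := by
  classical
  refine ⟨Pi.single ⟨d, hd⟩ (Ideal.Quotient.mk _ 1), ?_⟩
  rw [decompositionMap, LinearMap.sum_apply, Finset.sum_eq_single ⟨d, hd⟩]
  · rw [LinearMap.comp_apply, LinearMap.proj_apply, Pi.single_eq_same]
    exact one_smul (Polynomial k) _
  · intro b _ hb
    rw [LinearMap.comp_apply, LinearMap.proj_apply, Pi.single_eq_of_ne hb, map_zero]
  · simp

theorem decompositionMap_surjective [CharZero k] {m n : ℕ} (hmn : m ≤ n) :
    Function.Surjective (decompositionMap k hmn) := by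
  let I := powIdeal k (m + 1) (n + 1)
  let N := LinearMap.range (decompositionMap k hmn)
  let W := N.restrictScalars k ⊔
    LinearMap.range (LinearMap.mulLeft k (Ideal.Quotient.mk I (X 0 + X 1)))
  have hV : W.comap (Ideal.Quotient.mkₐ k I).toLinearMap = ⊤ := by
    have h0 : ∀ q, (X 0 + X 1) * q ∈ W.comap (Ideal.Quotient.mkₐ k I).toLinearMap := fun q =>
      Submodule.mem_sup_right ⟨Ideal.Quotient.mk I q, (map_mul (Ideal.Quotient.mk I) _ _).symm⟩
    refine eq_top_of_X_pow_mem (e := m + 1) h0 (fun q => ?_) fun d hd =>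
      X_pow_mem_of_highestWeightVector_mem m n d h0
        (Submodule.mem_sup_left (mk_highestWeightVector_mem_range hmn hd))
    have : Ideal.Quotient.mk I (X 0 ^ (m + 1) * q) = 0 :=
      Ideal.Quotient.eq_zero_iff_mem.2 (Ideal.mul_mem_right _ _ (Ideal.subset_span (by simp)))
    rw [Submodule.mem_comap]
    exact this ▸ W.zero_mem
  have step (q : MvPolynomial (Fin 2) k) :
      ∃ r, Ideal.Quotient.mk I q - (Polynomial.X : Polynomial k) • Ideal.Quotient.mk I r ∈ N := by
    have hq : q ∈ W.comap (Ideal.Quotient.mkₐ k I).toLinearMap := hV ▸ Submodule.mem_top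
    obtain ⟨a, ha, _, ⟨r, rfl⟩, h⟩ := Submodule.mem_sup.1 (Submodule.mem_comap.1 hq)
    obtain ⟨r, rfl⟩ := Ideal.Quotient.mk_surjective r
    refine ⟨r, ?_⟩
    rw [tPolyModule_smul_def, Polynomial.aeval_X]
    have h' : a = Ideal.Quotient.mk I q - Ideal.Quotient.mk I (X 0 + X 1) * Ideal.Quotient.mk I r :=
      eq_sub_of_add_eq h
    exact h' ▸ ha
  have iter (q : MvPolynomial (Fin 2) k) (j : ℕ) : ∃ r, Ideal.Quotient.mk I q -
      (Polynomial.X ^ j : Polynomial k) • Ideal.Quotient.mk I r ∈ N := by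
    induction j with
    | zero => exact ⟨q, by simp⟩
    | succ j ih =>
      obtain ⟨r, hr⟩ := ih
      obtain ⟨s, hs⟩ := step r
      refine ⟨s, ?_⟩
      convert N.add_mem hr (N.smul_mem (Polynomial.X ^ j) hs) using 1
      rw [smul_sub, smul_smul, ← pow_succ]
      abel
  intro r
  obtain ⟨q, rfl⟩ := Ideal.Quotient.mk_surjective r
  obtain ⟨r, hr⟩ := iter q (m + 1 + (n + 1))
  rwa [X_pow_smul_mk, Ideal.Quotient.eq_zero_iff_mem.2
    (Ideal.mul_mem_right _ _ (pow_add_mem_powIdeal _ _)), sub_zero] at hr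

/-- The map induced by `boxCoeff` on `k[x, y]/(x^e, y^f)`. -/
noncomputable def quotientBoxCoeff (k : Type*) [Field k] (e f : ℕ) :
    (MvPolynomial (Fin 2) k ⧸ powIdeal k e f) →ₗ[k] (Fin e × Fin f → k) :=
  ((powIdeal k e f).restrictScalars k).liftQ (boxCoeff k e f)
    (fun _ hp => boxCoeff_eq_zero hp) ∘ₗ
    (Submodule.Quotient.restrictScalarsEquiv k (powIdeal k e f)).symm.toLinearMap

theorem quotientBoxCoeff_surjective (e f : ℕ) : Function.Surjective (quotientBoxCoeff k e f) := by
  intro c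
  obtain ⟨p, rfl⟩ := boxCoeff_surjective e f c
  exact ⟨Ideal.Quotient.mk _ p, rfl⟩

theorem sum_range_jordan_sizes_add_sq {m n : ℕ} (hmn : m ≤ n) (r : ℕ) (hr : r ≤ m + 1) :
    ∑ d ∈ Finset.range r, (m + 1 + (n + 1) - 1 - 2 * d) + r * r = r * (m + n + 2) := by
  induction r with
  | zero => simp
  | succ r ih =>
    obtain ⟨c, hc⟩ : ∃ c, m + n + 1 = 2 * r + c := ⟨m + n + 1 - 2 * r, by omega⟩
    have h := ih (by omega)
    rw [Finset.sum_range_succ, show m + 1 + (n + 1) - 1 - 2 * r = c by omega]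
    linear_combination h - hc

instance finite_quotient_span_X_pow (j : ℕ) :
    Module.Finite k (Polynomial k ⧸ Ideal.span {(Polynomial.X : Polynomial k) ^ j}) :=
  (Polynomial.monic_X_pow j).finite_quotient

end Decomposition

/-- Let `k` be a field of characteristic `0` and `e ≤ f` positive integers.  Then
`R = k[x,y]/(x^e, y^f)`, viewed as a `k[t]`-module where `t` acts as multiplication by
`x + y`, is isomorphic to `⊕_{d=0}^{e-1} k[t]/(t^{e+f-1-2d})`. -/
theorem pontryagin_decomposition_one_variable
    (k : Type*) [Field k] [CharZero k] (e f : ℕ) (he : 0 < e) (hef : e ≤ f) :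
    Nonempty ((MvPolynomial (Fin 2) k ⧸
        Ideal.span {(X 0 : MvPolynomial (Fin 2) k) ^ e, (X 1 : MvPolynomial (Fin 2) k) ^ f})
      ≃ₗ[Polynomial k]
      ((d : Fin e) → Polynomial k ⧸
        Ideal.span {(Polynomial.X : Polynomial k) ^ (e + f - 1 - 2 * (d : ℕ))})) := by
  obtain ⟨m, rfl⟩ : ∃ m, e = m + 1 := ⟨e - 1, by omega⟩
  obtain ⟨n, rfl⟩ : ∃ n, f = n + 1 := ⟨f - 1, by omega⟩
  have hmn : m ≤ n := by omega
  let φ := decompositionMap k hmn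
  refine ⟨(LinearEquiv.ofBijective φ ⟨?_, decompositionMap_surjective hmn⟩).symm⟩
  have hφ : Function.Surjective (φ.restrictScalars k) := decompositionMap_surjective hmn
  have hψ := (quotientBoxCoeff_surjective (k := k) (m + 1) (n + 1)).comp hφ
  rw [← LinearMap.coe_comp, ← LinearMap.injective_iff_surjective_of_finrank_eq_finrank] at hψ
  · exact Function.Injective.of_comp (f := quotientBoxCoeff k (m + 1) (n + 1)) hψ
  · simp only [Module.finrank_pi_fintype, finrank_quotient_span_eq_natDegree,
      Polynomial.natDegree_X_pow, Module.finrank_self, Finset.sum_const, Finset.card_univ,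
      Fintype.card_prod, Fintype.card_fin, smul_eq_mul, mul_one]
    rw [Fin.sum_univ_eq_sum_range (fun d => m + 1 + (n + 1) - 1 - 2 * d) (m + 1)]
    have := sum_range_jordan_sizes_add_sq (m := m) (n := n) hmn (m + 1) le_rfl
    nlinarith
end

section
/- Let k be a field of characteristic 0, let e ≤ f be positive integers, let R = k[x, y]/(x^e, y^f) with its standard grading, and fix 0 ≤ d ≤ e − 1. For each 0 ≤ j ≤ d let w_j be a nonzero homogeneous element of R of degree j with (x + y)^{e+f−2j−1} · w_j = 0. Then the d + 1 elements (x + y)^{d−j} · w_j, for 0 ≤ j ≤ d, form a k-basis of the degree-d homogeneous component of R (which has dimension d + 1). -/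
open MvPolynomial

section Dehomogenization

variable {k : Type*} [Field k]

/-- If a product with `(1 + X) ^ m` has a gap in its coefficients just below degree `e`, as happens
for multiples of powers of `x + y` lying in `(x ^ e, y ^ f)`, then the other factor vanishes. -/
theorem Polynomial.eq_zero_of_coeff_one_add_X_pow_mul [CharZero k] {e f j m : ℕ}
    (hm : m + 2 * j + 2 = e + f) (hje : j < e) (hjf : j < f) {w : Polynomial k}
    (hw : w.natDegree ≤ j)
    (hq : ∀ i, i < e → e < i + j + 2 → ((1 + Polynomial.X) ^ m * w).coeff i = 0) :
    w = 0 := by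
  set L : Polynomial k := 1 + Polynomial.X with hL
  have hL1 : L = Polynomial.X + Polynomial.C 1 := by rw [hL, map_one, add_comm]
  have hLm : L.Monic := hL1 ▸ Polynomial.monic_X_add_C 1
  have hLd : L.natDegree = 1 := hL1 ▸ Polynomial.natDegree_X_add_C 1
  set q := L ^ m * w with hqdef
  have hX : (Polynomial.X ^ e : Polynomial k).Monic := Polynomial.monic_X_pow e
  set A := q /ₘ Polynomial.X ^ e with hA
  set B := q %ₘ Polynomial.X ^ e with hB
  have hAB : B + Polynomial.X ^ e * A = q := Polynomial.modByMonic_add_div q _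
  have hqd : q.natDegree ≤ m + j := by
    refine Polynomial.natDegree_mul_le.trans ?_
    have := Polynomial.natDegree_pow_le (p := L) (n := m)
    rw [hLd] at this
    lia
  have hAd : A.natDegree ≤ m + j - e := by
    rw [hA, Polynomial.natDegree_divByMonic _ hX, Polynomial.natDegree_X_pow]
    lia
  have hBe : B.degree < e := by
    simpa using Polynomial.degree_modByMonic_lt q hX
  have hBc : ∀ i, e < i + j + 2 → B.coeff i = 0 := by
    intro i hi
    by_cases hie : i < e
    · have := hq i hie hi
      rw [← hAB, Polynomial.coeff_add, Polynomial.coeff_X_pow_mul', if_neg (by lia), add_zero]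
        at this
      exact this
    · exact Polynomial.coeff_eq_zero_of_degree_lt (hBe.trans_le (by exact_mod_cast not_lt.mp hie))
  by_contra hw0
  have hq0 : q ≠ 0 := mul_ne_zero (pow_ne_zero _ hLm.ne_zero) hw0
  have hqn : q.natDegree = m + w.natDegree := by
    rw [hqdef, Polynomial.natDegree_mul (pow_ne_zero _ hLm.ne_zero) hw0,
      Polynomial.natDegree_pow, hLd, mul_one]
  have hcop : IsCoprime L (Polynomial.X : Polynomial k) := ⟨1, -1, by rw [hL]; ring⟩
  have hB0 : B ≠ 0 := by
    intro h
    rw [h, zero_add] at hAB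
    have hdvd : Polynomial.X ^ e ∣ w :=
      (hcop.symm.pow (m := e) (n := m)).dvd_of_dvd_mul_left ⟨A, hAB.symm⟩
    have := Polynomial.natDegree_le_of_dvd hdvd hw0
    rw [Polynomial.natDegree_X_pow] at this
    lia
  have hBd : B.natDegree + j + 2 ≤ e := by
    by_contra h
    exact hB0 (Polynomial.leadingCoeff_eq_zero.mp (hBc B.natDegree (by lia)))
  have hA0 : A ≠ 0 := by
    intro h
    rw [h, mul_zero, add_zero] at hAB
    rw [← hAB] at hqn
    lia
  have hAe : A.natDegree + e ≤ m + j := by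
    have h1 : (Polynomial.X ^ e * A).natDegree = e + A.natDegree := by
      rw [Polynomial.natDegree_mul hX.ne_zero hA0, Polynomial.natDegree_X_pow]
    have h2 : Polynomial.X ^ e * A = q - B := by rw [← hAB]; ring
    have h3 := Polynomial.natDegree_sub_le q B
    rw [← h2, h1] at h3
    have : B.natDegree ≤ m + j := by lia
    have := max_le hqd this
    lia
  obtain ⟨e', rfl⟩ : ∃ e', e = e' + 1 := ⟨e - 1, by lia⟩
  obtain ⟨m', rfl⟩ : ∃ m', m = m' + 1 := ⟨m - 1, by lia⟩
  -- `X ^ (e - 1) * W` is the Wronskian of `X ^ e * A` and `B`.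
  set W := ((e' + 1 : ℕ) : Polynomial k) * (A * B) +
    Polynomial.X * (Polynomial.derivative A * B - A * Polynomial.derivative B) with hW
  have hWr : Polynomial.X ^ e' * W =
      L ^ m' * ((((m' + 1 : ℕ) : Polynomial k) * w + L * Polynomial.derivative w) * B
        - L * w * Polynomial.derivative B) := by
    have hdL : Polynomial.derivative L = 1 := by simp [hL]
    have hd := congrArg Polynomial.derivative hAB
    simp only [hqdef, Polynomial.derivative_add, Polynomial.derivative_mul,
      Polynomial.derivative_pow, Polynomial.derivative_X, hdL, Polynomial.C_eq_natCast,
      Nat.add_sub_cancel] at hd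
    rw [hqdef] at hAB
    rw [hW]
    linear_combination B * hd - Polynomial.derivative B * hAB
  have hdvd : L ^ m' ∣ W :=
    (hcop.pow (m := m') (n := e')).dvd_of_dvd_mul_left ⟨_, hWr⟩
  have hXd (p : Polynomial k) (n : ℕ) :
      (Polynomial.X * Polynomial.derivative p).coeff n = n * p.coeff n := by
    cases n with
    | zero => simp
    | succ n => rw [Polynomial.coeff_X_mul, Polynomial.coeff_derivative]; push_cast; ring
  have hXdeg (p : Polynomial k) :
      (Polynomial.X * Polynomial.derivative p).natDegree ≤ p.natDegree := by
    rw [Polynomial.natDegree_le_iff_coeff_eq_zero]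
    intro n hn
    rw [hXd, Polynomial.coeff_eq_zero_of_natDegree_lt hn, mul_zero]
  have hW' : W = ((e' + 1 : ℕ) : Polynomial k) * (A * B) +
      (Polynomial.X * Polynomial.derivative A * B -
        A * (Polynomial.X * Polynomial.derivative B)) := by
    rw [hW]; ring
  have hcoeff : W.coeff (A.natDegree + B.natDegree) =
      ((e' + 1 : ℕ) + A.natDegree - B.natDegree : k) * (A.leadingCoeff * B.leadingCoeff) := by
    rw [hW', Polynomial.coeff_add, Polynomial.coeff_sub, Polynomial.coeff_natCast_mul,
      Polynomial.coeff_mul_add_eq_of_natDegree_le le_rfl le_rfl,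
      Polynomial.coeff_mul_add_eq_of_natDegree_le (hXdeg A) le_rfl,
      Polynomial.coeff_mul_add_eq_of_natDegree_le le_rfl (hXdeg B), hXd, hXd,
      Polynomial.leadingCoeff, Polynomial.leadingCoeff]
    ring
  have hWd : W.natDegree ≤ A.natDegree + B.natDegree := by
    rw [hW']
    refine Polynomial.natDegree_add_le_of_degree_le ?_
      (Polynomial.natDegree_sub_le_of_le ?_ ?_ |>.trans (max_self _).le)
    · rw [← nsmul_eq_mul]
      exact (Polynomial.natDegree_smul_le _ _).trans Polynomial.natDegree_mul_le
    · exact Polynomial.natDegree_mul_le_of_le (hXdeg A) le_rfl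
    · exact Polynomial.natDegree_mul_le_of_le le_rfl (hXdeg B)
  have hWc : W.coeff (A.natDegree + B.natDegree) ≠ 0 := by
    rw [hcoeff]
    refine mul_ne_zero ?_ (mul_ne_zero (Polynomial.leadingCoeff_ne_zero.mpr hA0)
      (Polynomial.leadingCoeff_ne_zero.mpr hB0))
    rw [sub_ne_zero]
    norm_cast
    lia
  have hW0 : W ≠ 0 := fun h => hWc (by rw [h, Polynomial.coeff_zero])
  have := Polynomial.natDegree_le_of_dvd hdvd hW0
  rw [Polynomial.natDegree_pow, hLd] at this
  lia

theorem MvPolynomial.IsHomogeneous.apply_zero_add_apply_one {D : ℕ} {p : MvPolynomial (Fin 2) k}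
    (hp : p.IsHomogeneous D) {u : Fin 2 →₀ ℕ} (hu : coeff u p ≠ 0) : u 0 + u 1 = D := by
  have := hp hu
  rw [Finsupp.weight_apply, Finsupp.sum_fintype _ _ (by simp)] at this
  simpa [Fin.sum_univ_two] using this

/-- The coefficients of the dehomogenization of a binary form. -/
theorem MvPolynomial.IsHomogeneous.coeff_aeval_X_one {D : ℕ} {p : MvPolynomial (Fin 2) k}
    (hp : p.IsHomogeneous D) {i : ℕ} (v : Fin 2 →₀ ℕ) (hv0 : v 0 = i) (hv1 : v 0 + v 1 = D) :
    (MvPolynomial.aeval ![Polynomial.X, (1 : Polynomial k)] p).coeff i = coeff v p := by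
  rw [MvPolynomial.aeval_def, eval₂_eq', Polynomial.finsetSum_coeff, Finset.sum_eq_single v]
  · simp [Fin.prod_univ_two, ← hv0]
  · intro u hu huv
    have hu1 := hp.apply_zero_add_apply_one (mem_support_iff.mp hu)
    have : i ≠ u 0 := by
      rintro rfl
      refine huv (Finsupp.ext fun a => ?_)
      fin_cases a
      · exact hv0.symm
      · change u 1 = v 1
        lia
    simp [Fin.prod_univ_two, Polynomial.coeff_X_pow, this]
  · intro h
    rw [notMem_support_iff.mp h]
    simp

theorem MvPolynomial.IsHomogeneous.natDegree_aeval_X_one_le {D : ℕ} {p : MvPolynomial (Fin 2) k}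
    (hp : p.IsHomogeneous D) :
    (MvPolynomial.aeval ![Polynomial.X, (1 : Polynomial k)] p).natDegree ≤ D := by
  rw [MvPolynomial.aeval_def, eval₂_eq']
  refine Polynomial.natDegree_sum_le_of_forall_le _ _ fun u hu => ?_
  have := hp.apply_zero_add_apply_one (mem_support_iff.mp hu)
  simp only [Polynomial.algebraMap_eq, Fin.prod_univ_two, Matrix.cons_val_zero,
    Matrix.cons_val_one, one_pow, mul_one]
  exact (Polynomial.natDegree_C_mul_X_pow_le _ _).trans (by lia)

theorem MvPolynomial.coeff_eq_zero_of_mem_span_X_pow {e f : ℕ} {p : MvPolynomial (Fin 2) k}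
    (hp : p ∈ Ideal.span {(X 0 : MvPolynomial (Fin 2) k) ^ e, (X 1 : MvPolynomial (Fin 2) k) ^ f})
    {u : Fin 2 →₀ ℕ} (h0 : u 0 < e) (h1 : u 1 < f) : coeff u p = 0 := by
  obtain ⟨a, b, rfl⟩ := Ideal.mem_span_pair.mp hp
  rw [coeff_add, X_pow_eq_monomial, X_pow_eq_monomial, coeff_mul_monomial', coeff_mul_monomial',
    if_neg, if_neg, add_zero]
  · intro h
    have := h 1
    simp at this
    lia
  · intro h
    have := h 0
    simp at this
    lia

/-- Injectivity in the strong Lefschetz property of `k[x, y] / (x ^ e, y ^ f)`. -/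
theorem MvPolynomial.IsHomogeneous.eq_zero_of_X_add_X_pow_mul_mem [CharZero k] {e f j m : ℕ}
    (hm : m + 2 * j + 2 = e + f) (hje : j < e) (hjf : j < f) {w : MvPolynomial (Fin 2) k}
    (hw : w.IsHomogeneous j)
    (hmem : (X 0 + X 1) ^ m * w ∈
      Ideal.span {(X 0 : MvPolynomial (Fin 2) k) ^ e, (X 1 : MvPolynomial (Fin 2) k) ^ f}) :
    w = 0 := by
  have hL : ((X 0 + X 1 : MvPolynomial (Fin 2) k) ^ m).IsHomogeneous m := by
    simpa using ((isHomogeneous_X k (0 : Fin 2)).add (isHomogeneous_X k (1 : Fin 2))).pow m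
  have hq : ((X 0 + X 1) ^ m * w).IsHomogeneous (m + j) := hL.mul hw
  have haeval : MvPolynomial.aeval ![Polynomial.X, (1 : Polynomial k)] w = 0 := by
    refine Polynomial.eq_zero_of_coeff_one_add_X_pow_mul hm hje hjf
      hw.natDegree_aeval_X_one_le fun i hie hei => ?_
    have hmap : MvPolynomial.aeval ![Polynomial.X, (1 : Polynomial k)] ((X 0 + X 1) ^ m * w) =
        (1 + Polynomial.X) ^ m * MvPolynomial.aeval ![Polynomial.X, (1 : Polynomial k)] w := by
      simp [add_comm]
    rw [← hmap]
    by_cases hi : i ≤ m + j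
    · let v : Fin 2 →₀ ℕ := Finsupp.equivFunOnFinite.symm ![i, m + j - i]
      have hv0 : v 0 = i := rfl
      have hv1 : v 1 = m + j - i := rfl
      rw [hq.coeff_aeval_X_one v hv0 (by lia)]
      exact coeff_eq_zero_of_mem_span_X_pow hmem (by lia) (by lia)
    · exact Polynomial.coeff_eq_zero_of_natDegree_lt
        (hq.natDegree_aeval_X_one_le.trans_lt (by lia))
  ext u
  rw [coeff_zero]
  by_contra hu
  apply hu
  rw [← hw.coeff_aeval_X_one u rfl (hw.apply_zero_add_apply_one hu), haeval, Polynomial.coeff_zero]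

theorem MvPolynomial.IsHomogeneous.mk_mem_span_monomials {d : ℕ} {p : MvPolynomial (Fin 2) k}
    (hp : p.IsHomogeneous d) (I : Ideal (MvPolynomial (Fin 2) k)) :
    Ideal.Quotient.mk I p ∈ Submodule.span k (Set.range fun i : Fin (d + 1) =>
      Ideal.Quotient.mk I (X 0 ^ (i : ℕ) * X 1 ^ (d - (i : ℕ)))) := by
  rw [p.as_sum, map_sum]
  refine Submodule.sum_mem _ fun u hu => ?_
  have hud := hp.apply_zero_add_apply_one (mem_support_iff.mp hu)
  have hmon : monomial u (coeff u p) = coeff u p • (X 0 ^ u 0 * X 1 ^ (d - u 0)) := by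
    rw [monomial_eq, Finsupp.prod_fintype _ _ (by simp), Fin.prod_univ_two, smul_eq_C_mul,
      show d - u 0 = u 1 by lia]
  rw [hmon]
  change Ideal.Quotient.mkₐ k I _ ∈ _
  rw [map_smul]
  exact Submodule.smul_mem _ _ (Submodule.subset_span ⟨⟨u 0, by lia⟩, rfl⟩)

end Dehomogenization

/-- Let `k` be a field of characteristic `0`, `e ≤ f` positive integers,
`R = k[x,y]/(x^e, y^f)` with its standard grading, and `0 ≤ d ≤ e - 1`.  If for each
`0 ≤ j ≤ d` the element `w j` is a nonzero homogeneous element of degree `j` of `R` with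
`(x+y)^(e+f-2j-1) ⬝ w j = 0`, then the `d+1` elements `(x+y)^(d-j) ⬝ w j` form a `k`-basis
of the degree-`d` homogeneous component of `R` (the span of the images of the monomials
`x^i y^(d-i)`), which has dimension `d + 1`. -/
theorem basis_of_degree_d_component
    (k : Type*) [Field k] [CharZero k] (e f : ℕ) (he : 0 < e) (hef : e ≤ f)
    (d : ℕ) (hd : d ≤ e - 1) (w : Fin (d + 1) → MvPolynomial (Fin 2) k)
    (hhom : ∀ j : Fin (d + 1), (w j).IsHomogeneous (j : ℕ))
    (hne : ∀ j : Fin (d + 1),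
      Ideal.Quotient.mk
        (Ideal.span {(X 0 : MvPolynomial (Fin 2) k) ^ e, (X 1 : MvPolynomial (Fin 2) k) ^ f})
        (w j) ≠ 0)
    (hkill : ∀ j : Fin (d + 1),
      Ideal.Quotient.mk
        (Ideal.span {(X 0 : MvPolynomial (Fin 2) k) ^ e, (X 1 : MvPolynomial (Fin 2) k) ^ f})
        ((X 0 + X 1) ^ (e + f - 2 * (j : ℕ) - 1) * w j) = 0) :
    LinearIndependent k (fun j : Fin (d + 1) =>
        Ideal.Quotient.mk
          (Ideal.span {(X 0 : MvPolynomial (Fin 2) k) ^ e, (X 1 : MvPolynomial (Fin 2) k) ^ f})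
          ((X 0 + X 1) ^ (d - (j : ℕ)) * w j)) ∧
      Submodule.span k (Set.range fun j : Fin (d + 1) =>
          Ideal.Quotient.mk
            (Ideal.span {(X 0 : MvPolynomial (Fin 2) k) ^ e, (X 1 : MvPolynomial (Fin 2) k) ^ f})
            ((X 0 + X 1) ^ (d - (j : ℕ)) * w j)) =
        Submodule.span k (Set.range fun i : Fin (d + 1) =>
          Ideal.Quotient.mk
            (Ideal.span {(X 0 : MvPolynomial (Fin 2) k) ^ e, (X 1 : MvPolynomial (Fin 2) k) ^ f})
            (X 0 ^ (i : ℕ) * X 1 ^ (d - (i : ℕ)))) ∧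
      Module.finrank k
          (Submodule.span k (Set.range fun i : Fin (d + 1) =>
            Ideal.Quotient.mk
              (Ideal.span
                {(X 0 : MvPolynomial (Fin 2) k) ^ e, (X 1 : MvPolynomial (Fin 2) k) ^ f})
              (X 0 ^ (i : ℕ) * X 1 ^ (d - (i : ℕ))))) = d + 1 := by
  set I := Ideal.span
    {(X 0 : MvPolynomial (Fin 2) k) ^ e, (X 1 : MvPolynomial (Fin 2) k) ^ f} with hI
  have hli : LinearIndependent k (fun j : Fin (d + 1) =>
      Ideal.Quotient.mk I ((X 0 + X 1) ^ (d - (j : ℕ)) * w j)) := by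
    rw [Fintype.linearIndependent_iff]
    intro g hg i
    induction i using WellFoundedLT.induction with
    | ind i ih =>
    by_contra hgi
    have hmul := congrArg
      (fun z => Ideal.Quotient.mk I ((X 0 + X 1) ^ (e + f - 2 - d - (i : ℕ))) * z) hg
    simp only [Finset.mul_sum, mul_zero, mul_smul_comm, ← map_mul, ← mul_assoc, ← pow_add] at hmul
    rw [Finset.sum_eq_single i] at hmul
    · have hzero := (smul_eq_zero.mp hmul).resolve_left hgi
      have hw0 : w i = 0 := (hhom i).eq_zero_of_X_add_X_pow_mul_mem (by lia) (by lia) (by lia)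
        (Ideal.Quotient.eq_zero_iff_mem.mp hzero)
      exact hne i (by rw [hw0, map_zero])
    · intro j _ hji
      rcases lt_or_gt_of_ne hji with hlt | hgt
      · rw [ih j hlt, zero_smul]
      · have hgt' : (i : ℕ) < j := hgt
        have hsplit : e + f - 2 - d - (i : ℕ) + (d - (j : ℕ)) =
            (j - i - 1 : ℕ) + (e + f - 2 * (j : ℕ) - 1) := by lia
        rw [hsplit, pow_add, mul_assoc, map_mul, hkill j, mul_zero, smul_zero]
    · simp
  have hle : Submodule.span k (Set.range fun j : Fin (d + 1) =>
        Ideal.Quotient.mk I ((X 0 + X 1) ^ (d - (j : ℕ)) * w j)) ≤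
      Submodule.span k (Set.range fun i : Fin (d + 1) =>
        Ideal.Quotient.mk I (X 0 ^ (i : ℕ) * X 1 ^ (d - (i : ℕ)))) := by
    rw [Submodule.span_le]
    rintro _ ⟨j, rfl⟩
    refine IsHomogeneous.mk_mem_span_monomials ?_ I
    have h := (((isHomogeneous_X k (0 : Fin 2)).add (isHomogeneous_X k (1 : Fin 2))).pow
      (d - (j : ℕ))).mul (hhom j)
    rwa [show 1 * (d - (j : ℕ)) + (j : ℕ) = d by lia] at h
  have hrank := finrank_span_eq_card hli
  rw [Fintype.card_fin] at hrank
  have hrank_le := finrank_range_le_card (R := k) fun i : Fin (d + 1) =>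
    Ideal.Quotient.mk I (X 0 ^ (i : ℕ) * X 1 ^ (d - (i : ℕ)))
  rw [Fintype.card_fin, Set.finrank] at hrank_le
  have hfin : FiniteDimensional k (Submodule.span k (Set.range fun i : Fin (d + 1) =>
      Ideal.Quotient.mk I (X 0 ^ (i : ℕ) * X 1 ^ (d - (i : ℕ))))) :=
    FiniteDimensional.span_of_finite k (Set.finite_range _)
  have hspan := Submodule.eq_of_le_of_finrank_le hle (by rw [hrank]; exact hrank_le)
  exact ⟨hli, hspan, hspan ▸ hrank⟩
end
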